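/- arXiv:math/0410503 — 2 statements merged into one kernel-verified Lean document; each statement's English description precedes it below -/
import Mathlib

section
/- Let C be a connected chain coalgebra over R. Then the based-path coalgebra 𝔓(C) is a connected chain coalgebra: d̃ ∘ d̃ = 0; the comultiplication Δ̃ is coassociative, counital (with counit ε ∘ π), and is a chain map; the projection π : 𝔓(C) → C is a surjective morphism of chain coalgebras; and 𝔓(C) is acyclic, i.e., the homology of (𝔓(C), d̃) is isomorphic to R, concentrated in degree 0. -/
/-!
Statement 5: the based-path construction `𝔓(C)` on a connected chain coalgebra `C` is an
acyclic connected chain coalgebra, and the projection `π : 𝔓(C) → C` is a surjective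
morphism of chain coalgebras.
-/

open scoped TensorProduct

namespace Stmt5

/-- A non-negatively graded chain complex structure on an `R`-module `A`. -/
structure GradedChain (R A : Type) [CommRing R] [AddCommGroup A] [Module R A] where
  gr : ℕ → Submodule R A
  internal : DirectSum.IsInternal gr
  free : ∀ n, Module.Free R (gr n)
  d : A →ₗ[R] A
  d_mem : ∀ n, ∀ x ∈ gr (n + 1), d x ∈ gr n
  d_zero : ∀ x ∈ gr 0, d x = 0
  d_sq : ∀ x, d (d x) = 0

variable {R A B : Type} [CommRing R]

/-- The submodule of `A ⊗ B` generated by tensors of elements of `P` and `Q`. -/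
noncomputable def tensorPiece [AddCommGroup A] [Module R A] [AddCommGroup B] [Module R B]
    (P : Submodule R A) (Q : Submodule R B) : Submodule R (A ⊗[R] B) :=
  LinearMap.range (TensorProduct.map P.subtype Q.subtype)

/-- The degree-`n` part of the tensor product of two graded modules. -/
noncomputable def tensorDeg [AddCommGroup A] [Module R A] [AddCommGroup B] [Module R B]
    (gr : ℕ → Submodule R A) (gr' : ℕ → Submodule R B) (n : ℕ) :
    Submodule R (A ⊗[R] B) :=
  ⨆ p : {p : ℕ × ℕ // p.1 + p.2 = n}, tensorPiece (gr p.1.1) (gr' p.1.2)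

/-- Chain coalgebra laws for `(Δ, ε)` on the graded chain complex `G`. -/
structure ChainCoalgLaws [AddCommGroup A] [Module R A] (G : GradedChain R A)
    (Δ : A →ₗ[R] A ⊗[R] A) (ε : A →ₗ[R] R) : Prop where
  coassoc : ∀ x, (TensorProduct.assoc R A A A) ((TensorProduct.map Δ LinearMap.id) (Δ x))
      = (TensorProduct.map LinearMap.id Δ) (Δ x)
  counit_l : ∀ x, (TensorProduct.lid R A) ((TensorProduct.map ε LinearMap.id) (Δ x)) = x
  counit_r : ∀ x, (TensorProduct.rid R A) ((TensorProduct.map LinearMap.id ε) (Δ x)) = x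
  deg : ∀ n, ∀ x ∈ G.gr n, Δ x ∈ tensorDeg G.gr G.gr n
  chain : ∀ (ι : Type) (s : Finset ι) (a b : ι → A) (da : ι → ℕ) (x : A),
    (∀ i ∈ s, a i ∈ G.gr (da i)) →
    Δ x = ∑ i ∈ s, a i ⊗ₜ[R] b i →
    Δ (G.d x) = ∑ i ∈ s, (G.d (a i) ⊗ₜ[R] b i + ((-1 : ℤ) ^ (da i)) • (a i ⊗ₜ[R] G.d (b i)))

/-- Connectedness of a chain coalgebra: there is a grouplike element `e` spanning the
degree-0 part faithfully. -/
structure CoalgConnected [AddCommGroup A] [Module R A] (G : GradedChain R A)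
    (Δ : A →ₗ[R] A ⊗[R] A) (ε : A →ₗ[R] R) (e : A) : Prop where
  mem : e ∈ G.gr 0
  grouplike : Δ e = e ⊗ₜ[R] e
  counit : ε e = 1
  span : G.gr 0 ≤ Submodule.span R {e}
  faithful : ∀ r : R, r • e = 0 → r = 0

section GradedModules

variable [AddCommGroup A] [Module R A] [AddCommGroup B] [Module R B]

/-- The endomorphism of an internally graded module acting on the degree-`n` part as
multiplication by `c n`. -/
noncomputable def gradedScale {gr : ℕ → Submodule R A} (h : DirectSum.IsInternal gr)
    (c : ℕ → R) : A →ₗ[R] A :=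
  DirectSum.toModule R ℕ A (fun n => c n • (gr n).subtype) ∘ₗ
    (LinearEquiv.ofBijective (DirectSum.coeLinearMap gr) h).symm.toLinearMap

theorem gradedScale_apply {gr : ℕ → Submodule R A} (h : DirectSum.IsInternal gr)
    (c : ℕ → R) {n : ℕ} {x : A} (hx : x ∈ gr n) : gradedScale h c x = c n • x := by
  have hsymm : (LinearEquiv.ofBijective (DirectSum.coeLinearMap gr) h).symm x
      = DirectSum.lof R ℕ (fun i => gr i) n ⟨x, hx⟩ := by
    rw [LinearEquiv.symm_apply_eq]
    exact (DirectSum.coeLinearMap_lof gr n ⟨x, hx⟩).symm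
  simp only [gradedScale, LinearMap.comp_apply, LinearEquiv.coe_coe, hsymm,
    DirectSum.toModule_lof]
  rfl

/-- The Koszul sign operator `x ↦ (-1) ^ |x| • x`. -/
noncomputable def koszulSign {gr : ℕ → Submodule R A} (h : DirectSum.IsInternal gr) :
    A →ₗ[R] A :=
  gradedScale h fun n => (-1) ^ n

theorem koszulSign_apply {gr : ℕ → Submodule R A} (h : DirectSum.IsInternal gr)
    {n : ℕ} {x : A} (hx : x ∈ gr n) : koszulSign h x = (-1 : R) ^ n • x :=
  gradedScale_apply h _ hx

theorem homogeneous_induction {gr : ℕ → Submodule R A} (h : DirectSum.IsInternal gr)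
    {p : A → Prop} (hom : ∀ n, ∀ x ∈ gr n, p x) (zero : p 0)
    (add : ∀ x y, p x → p y → p (x + y)) (x : A) : p x := by
  have hx : x ∈ ⨆ n, gr n := by rw [h.submodule_iSup_eq_top]; trivial
  exact Submodule.iSup_induction gr (motive := p) hx hom zero add

theorem linearMap_ext_homogeneous {gr : ℕ → Submodule R A} (h : DirectSum.IsInternal gr)
    {f g : A →ₗ[R] B} (hfg : ∀ n, ∀ x ∈ gr n, f x = g x) (x : A) : f x = g x :=
  homogeneous_induction h hfg (by simp) (fun x y hx hy => by simp [hx, hy]) x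

theorem tmul_mem_tensorDeg {gr : ℕ → Submodule R A} {gr' : ℕ → Submodule R B} {p q n : ℕ}
    (hn : p + q = n) {x : A} {y : B} (hx : x ∈ gr p) (hy : y ∈ gr' q) :
    x ⊗ₜ[R] y ∈ tensorDeg gr gr' n := by
  refine Submodule.mem_iSup_of_mem ⟨(p, q), hn⟩ ?_
  exact ⟨⟨x, hx⟩ ⊗ₜ ⟨y, hy⟩, by simp⟩

theorem tensorDeg_induction {gr : ℕ → Submodule R A} {gr' : ℕ → Submodule R B} {n : ℕ}
    {P : A ⊗[R] B → Prop}
    (tmul : ∀ p q, p + q = n → ∀ x ∈ gr p, ∀ y ∈ gr' q, P (x ⊗ₜ y)) (zero : P 0)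
    (add : ∀ u v, P u → P v → P (u + v)) {t : A ⊗[R] B} (ht : t ∈ tensorDeg gr gr' n) :
    P t := by
  refine Submodule.iSup_induction _ (motive := P) ht ?_ zero add
  rintro ⟨⟨p, q⟩, hpq⟩ _ ⟨u, rfl⟩
  induction u using TensorProduct.induction_on with
  | zero => simpa using zero
  | tmul x y => exact tmul p q hpq x x.2 y y.2
  | add u v hu hv => rw [map_add]; exact add _ _ hu hv

/-- Every tensor is a finite sum of pure tensors with homogeneous left factors. -/
theorem exists_homogeneous_sum {gr : ℕ → Submodule R A} (h : DirectSum.IsInternal gr)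
    (t : A ⊗[R] B) :
    ∃ (κ : Type) (s : Finset κ) (a : κ → A) (b : κ → B) (deg : κ → ℕ),
      (∀ i ∈ s, a i ∈ gr (deg i)) ∧ t = ∑ i ∈ s, a i ⊗ₜ[R] b i := by
  have zero : ∃ (κ : Type) (s : Finset κ) (a : κ → A) (b : κ → B) (deg : κ → ℕ),
      (∀ i ∈ s, a i ∈ gr (deg i)) ∧ (0 : A ⊗[R] B) = ∑ i ∈ s, a i ⊗ₜ[R] b i :=
    ⟨Unit, ∅, fun _ => 0, fun _ => 0, fun _ => 0, by simp, by simp⟩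
  have add : ∀ t u : A ⊗[R] B,
      (∃ (κ : Type) (s : Finset κ) (a : κ → A) (b : κ → B) (deg : κ → ℕ),
        (∀ i ∈ s, a i ∈ gr (deg i)) ∧ t = ∑ i ∈ s, a i ⊗ₜ[R] b i) →
      (∃ (κ : Type) (s : Finset κ) (a : κ → A) (b : κ → B) (deg : κ → ℕ),
        (∀ i ∈ s, a i ∈ gr (deg i)) ∧ u = ∑ i ∈ s, a i ⊗ₜ[R] b i) →
      ∃ (κ : Type) (s : Finset κ) (a : κ → A) (b : κ → B) (deg : κ → ℕ),
        (∀ i ∈ s, a i ∈ gr (deg i)) ∧ t + u = ∑ i ∈ s, a i ⊗ₜ[R] b i := by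
    rintro _ _ ⟨κ, s, a, b, deg, hd, rfl⟩ ⟨κ', s', a', b', deg', hd', rfl⟩
    refine ⟨κ ⊕ κ', s.disjSum s', Sum.elim a a', Sum.elim b b', Sum.elim deg deg', ?_, ?_⟩
    · rintro (i | i) hi
      · exact hd i (by simpa using hi)
      · exact hd' i (by simpa using hi)
    · simp [Finset.sum_disjSum]
  induction t using TensorProduct.induction_on with
  | zero => exact zero
  | tmul x y =>
    refine homogeneous_induction h (p := fun x => ∃ (κ : Type) (s : Finset κ) (a : κ → A)
      (b : κ → B) (deg : κ → ℕ),
      (∀ i ∈ s, a i ∈ gr (deg i)) ∧ x ⊗ₜ[R] y = ∑ i ∈ s, a i ⊗ₜ[R] b i) ?_ ?_ ?_ x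
    · intro n x hx
      exact ⟨Unit, {()}, fun _ => x, fun _ => y, fun _ => n, by simpa using hx, by simp⟩
    · simpa using zero
    · intro x x' hx hx'
      rw [TensorProduct.add_tmul]
      exact add _ _ hx hx'
  | add t u ht hu => exact add t u ht hu

/-- The explicit Koszul-signed sum agrees with its description by the sign operator. -/
theorem sum_koszul {A' B' : Type} [AddCommGroup A'] [Module R A'] [AddCommGroup B']
    [Module R B'] {gr : ℕ → Submodule R A} (h : DirectSum.IsInternal gr)
    (f f' : A →ₗ[R] A') (g g' : B →ₗ[R] B')
    {κ : Type} (s : Finset κ) (a : κ → A) (b : κ → B) (deg : κ → ℕ)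
    (ha : ∀ i ∈ s, a i ∈ gr (deg i)) :
    ∑ i ∈ s, (f (a i) ⊗ₜ[R] g (b i) + ((-1 : ℤ) ^ deg i) • (f' (a i) ⊗ₜ[R] g' (b i)))
      = TensorProduct.map f g (∑ i ∈ s, a i ⊗ₜ[R] b i)
        + TensorProduct.map (f' ∘ₗ koszulSign h) g' (∑ i ∈ s, a i ⊗ₜ[R] b i) := by
  rw [map_sum, map_sum, ← Finset.sum_add_distrib]
  refine Finset.sum_congr rfl fun i hi => ?_
  simp only [TensorProduct.map_tmul, LinearMap.comp_apply, koszulSign_apply h (ha i hi),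
    map_smul, ← TensorProduct.smul_tmul']
  congr 1
  rw [← Int.cast_smul_eq_zsmul R]
  simp

end GradedModules

namespace GradedChain

variable [AddCommGroup A] [Module R A] (G : GradedChain R A)

theorem d_koszulSign (x : A) :
    G.d (koszulSign G.internal x) = -koszulSign G.internal (G.d x) := by
  refine linearMap_ext_homogeneous (f := G.d ∘ₗ koszulSign G.internal)
    (g := -(koszulSign G.internal ∘ₗ G.d)) G.internal ?_ x
  rintro (_ | n) x hx
  · simp [koszulSign_apply G.internal hx, G.d_zero x hx]
  · simp [koszulSign_apply G.internal hx, koszulSign_apply G.internal (G.d_mem n x hx),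
      pow_succ]

end GradedChain

namespace ChainCoalgLaws

variable [AddCommGroup A] [Module R A] {G : GradedChain R A} {Δ : A →ₗ[R] A ⊗[R] A}
  {ε : A →ₗ[R] R}

theorem comul_d (h : ChainCoalgLaws G Δ ε) (x : A) :
    Δ (G.d x) = TensorProduct.map G.d LinearMap.id (Δ x)
      + TensorProduct.map (koszulSign G.internal) G.d (Δ x) := by
  obtain ⟨κ, s, a, b, deg, ha, hx⟩ := exists_homogeneous_sum G.internal (Δ x)
  rw [h.chain κ s a b deg x ha hx, hx]
  exact sum_koszul G.internal G.d LinearMap.id LinearMap.id G.d s a b deg ha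

theorem comul_koszulSign (h : ChainCoalgLaws G Δ ε) (x : A) :
    Δ (koszulSign G.internal x) =
      TensorProduct.map (koszulSign G.internal) (koszulSign G.internal) (Δ x) := by
  refine linearMap_ext_homogeneous (f := Δ ∘ₗ koszulSign G.internal)
    (g := TensorProduct.map (koszulSign G.internal) (koszulSign G.internal) ∘ₗ Δ)
    G.internal ?_ x
  intro n x hx
  have key : ∀ {t : A ⊗[R] A}, t ∈ tensorDeg G.gr G.gr n →
      (-1 : R) ^ n • t
        = TensorProduct.map (koszulSign G.internal) (koszulSign G.internal) t := by
    intro t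
    refine tensorDeg_induction (P := fun t => (-1 : R) ^ n • t
      = TensorProduct.map (koszulSign G.internal) (koszulSign G.internal) t) ?_ (by simp)
      fun u v hu hv => by rw [smul_add, hu, hv, map_add]
    intro p q hpq x hx y hy
    rw [TensorProduct.map_tmul, koszulSign_apply G.internal hx,
      koszulSign_apply G.internal hy, TensorProduct.smul_tmul_smul, ← pow_add, hpq]
  simp only [LinearMap.comp_apply, koszulSign_apply G.internal hx, map_smul]
  exact key (h.deg n x hx)

/-- Left counitality, evaluated on a linear form. -/
theorem counit_map_right (h : ChainCoalgLaws G Δ ε) (f : A →ₗ[R] R) (x : A) :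
    TensorProduct.lid R R (TensorProduct.map ε f (Δ x)) = f x := by
  conv_rhs => rw [← h.counit_l x]
  generalize Δ x = t
  induction t using TensorProduct.induction_on with
  | zero => simp
  | tmul x y => simp
  | add t u ht hu => simp only [map_add, ht, hu]

/-- Right counitality, evaluated on a linear form. -/
theorem counit_map_left (h : ChainCoalgLaws G Δ ε) (f : A →ₗ[R] R) (x : A) :
    TensorProduct.lid R R (TensorProduct.map f ε (Δ x)) = f x := by
  conv_rhs => rw [← h.counit_r x]
  generalize Δ x = t
  induction t using TensorProduct.induction_on with
  | zero => simp
  | tmul x y => simp [mul_comm]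
  | add t u ht hu => simp only [map_add, ht, hu]

/-- The counit vanishes in positive degrees. -/
theorem counit_eq_zero (h : ChainCoalgLaws G Δ ε) {n : ℕ} {x : A} (hx : x ∈ G.gr (n + 1)) :
    ε x = 0 := by
  set top := gradedScale G.internal (Pi.single (n + 1) (1 : R)) with htop
  set bot := gradedScale G.internal (Pi.single 0 (1 : R)) with hbot
  have key : ∀ {t : A ⊗[R] A}, t ∈ tensorDeg G.gr G.gr (n + 1) →
      TensorProduct.map (ε ∘ₗ top) ε t = TensorProduct.map ε (ε ∘ₗ bot) t := by
    intro t
    refine tensorDeg_induction (P := fun t => TensorProduct.map (ε ∘ₗ top) ε t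
      = TensorProduct.map ε (ε ∘ₗ bot) t) ?_ (by simp)
      fun u v hu hv => by simp only [map_add, hu, hv]
    intro p q hpq a ha b hb
    simp only [TensorProduct.map_tmul, LinearMap.comp_apply, htop, hbot,
      gradedScale_apply G.internal _ ha, gradedScale_apply G.internal _ hb]
    rcases q with _ | q
    · obtain rfl : p = n + 1 := by omega
      simp
    · have hp : p ≠ n + 1 := by omega
      simp [Pi.single_eq_of_ne hp]
  have h1 := h.counit_map_left (ε ∘ₗ top) x
  rw [key (h.deg _ x hx), h.counit_map_right] at h1
  simpa [htop, hbot, gradedScale_apply G.internal _ hx] using h1.symm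

theorem counit_koszulSign (h : ChainCoalgLaws G Δ ε) (x : A) :
    ε (koszulSign G.internal x) = ε x := by
  refine linearMap_ext_homogeneous (f := ε ∘ₗ koszulSign G.internal) (g := ε) G.internal ?_ x
  rintro (_ | n) x hx
  · simp [koszulSign_apply G.internal hx]
  · simp [koszulSign_apply G.internal hx, h.counit_eq_zero hx]

/-- The counit is an augmentation. -/
theorem counit_d (h : ChainCoalgLaws G Δ ε) (x : A) : ε (G.d x) = 0 := by
  have h1 := h.counit_map_right ε (G.d x)
  have h2 := h.counit_map_left (ε ∘ₗ G.d) x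
  have h3 := h.counit_map_right (ε ∘ₗ G.d) x
  have hs : ε ∘ₗ koszulSign G.internal = ε := LinearMap.ext h.counit_koszulSign
  rw [h.comul_d, map_add, map_add, ← LinearMap.comp_apply,
    ← LinearMap.comp_apply (f := TensorProduct.map ε ε), ← TensorProduct.map_comp,
    ← TensorProduct.map_comp, hs, LinearMap.comp_id, h2, h3] at h1
  simpa using h1

end ChainCoalgLaws

/-- Let `C` be a connected chain coalgebra over a PID `R`.  Then the
based-path object `𝔓(C)` — presented below by its defining formulas via the inclusion
`ι`, the suspension `σ(x) = x̄` (killing degree 0), the differential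
`d̃ι = ιd - σ`, `d̃σ = -σd`, and the comultiplication `Δ̃ι = (ι ⊗ ι)Δ`,
`Δ̃σ = (σ ⊗ ι + ι ⊗ σ)Δ` — is a connected chain coalgebra: `d̃ ∘ d̃ = 0`, `Δ̃` is
coassociative, counital with counit `ε ∘ π`, and a chain map; the projection `π` is a
surjective morphism of chain coalgebras; and `𝔓(C)` is acyclic, its homology being
isomorphic to `R` concentrated in degree `0`. -/
theorem based_path_coalgebra
    (R : Type) [CommRing R] [IsDomain R] [IsPrincipalIdealRing R]
    -- the connected chain coalgebra `C`
    (C : Type) [AddCommGroup C] [Module R C] (GC : GradedChain R C)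
    (Δ : C →ₗ[R] C ⊗[R] C) (ε : C →ₗ[R] R) (e : C)
    (hcoalg : ChainCoalgLaws GC Δ ε) (hconn : CoalgConnected GC Δ ε e)
    -- the underlying graded module of the based-path object `𝔓(C) = C ⊕ s(C₊)`
    (P : Type) [AddCommGroup P] [Module R P]
    (grP : ℕ → Submodule R P) (hint : DirectSum.IsInternal grP)
    (hfree : ∀ n, Module.Free R (grP n))
    (ι σ : C →ₗ[R] P) (π : P →ₗ[R] C)
    (hιmem : ∀ n, ∀ x ∈ GC.gr n, ι x ∈ grP n)
    (hσmem : ∀ n, ∀ x ∈ GC.gr (n + 1), σ x ∈ grP (n + 2))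
    (hσzero : ∀ x ∈ GC.gr 0, σ x = 0)
    (hιinj : ∀ x, ι x = 0 → x = 0)
    (hσker : ∀ y, σ y = 0 → y ∈ GC.gr 0)
    (hindep : ∀ x y : C, ι x + σ y = 0 → ι x = 0 ∧ σ y = 0)
    (hsurj : ∀ z : P, ∃ x y : C, z = ι x + σ y)
    (hsurj0 : ∀ z ∈ grP 0, ∃ x ∈ GC.gr 0, z = ι x)
    (hsurjn : ∀ n, ∀ z ∈ grP (n + 1),
      ∃ x y : C, x ∈ GC.gr (n + 1) ∧ y ∈ GC.gr n ∧ z = ι x + σ y)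
    (hπι : ∀ x, π (ι x) = x) (hπσ : ∀ x, π (σ x) = 0)
    -- the differential of `𝔓(C)`
    (dP : P →ₗ[R] P)
    (hdι : ∀ x, dP (ι x) = ι (GC.d x) - σ x)
    (hdσ : ∀ x, dP (σ x) = - σ (GC.d x))
    -- the comultiplication of `𝔓(C)`
    (ΔP : P →ₗ[R] P ⊗[R] P)
    (hΔι : ∀ x, ΔP (ι x) = (TensorProduct.map ι ι) (Δ x))
    (hΔσ : ∀ (κ : Type) (s : Finset κ) (a b : κ → C) (da : κ → ℕ) (x : C),
      (∀ i ∈ s, a i ∈ GC.gr (da i)) →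
      Δ x = ∑ i ∈ s, a i ⊗ₜ[R] b i →
      ΔP (σ x) = ∑ i ∈ s,
        (σ (a i) ⊗ₜ[R] ι (b i) + ((-1 : ℤ) ^ (da i)) • (ι (a i) ⊗ₜ[R] σ (b i)))) :
    -- (1) `d̃ ∘ d̃ = 0`
    (∀ z, dP (dP z) = 0) ∧
    -- (2) `Δ̃` is coassociative,
    (∀ z, (TensorProduct.assoc R P P P) ((TensorProduct.map ΔP LinearMap.id) (ΔP z))
        = (TensorProduct.map LinearMap.id ΔP) (ΔP z)) ∧
    -- counital with counit `ε ∘ π`,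
    (∀ z, (TensorProduct.lid R P) ((TensorProduct.map (ε ∘ₗ π) LinearMap.id) (ΔP z)) = z) ∧
    (∀ z, (TensorProduct.rid R P) ((TensorProduct.map LinearMap.id (ε ∘ₗ π)) (ΔP z)) = z) ∧
    -- of degree 0,
    (∀ n, ∀ z ∈ grP n, ΔP z ∈ tensorDeg grP grP n) ∧
    -- and a chain map (for the Koszul-signed differential on `𝔓(C) ⊗ 𝔓(C)`)
    (∀ (κ : Type) (s : Finset κ) (a b : κ → P) (da : κ → ℕ) (z : P),
      (∀ i ∈ s, a i ∈ grP (da i)) →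
      ΔP z = ∑ i ∈ s, a i ⊗ₜ[R] b i →
      ΔP (dP z) = ∑ i ∈ s,
        (dP (a i) ⊗ₜ[R] b i + ((-1 : ℤ) ^ (da i)) • (a i ⊗ₜ[R] dP (b i)))) ∧
    -- `𝔓(C)` is connected
    (grP 0 ≤ Submodule.span R {ι e}) ∧
    -- (3) `π` is a surjective morphism of chain coalgebras
    (Function.Surjective π) ∧
    (∀ z, π (dP z) = GC.d (π z)) ∧
    (∀ z, (TensorProduct.map π π) (ΔP z) = Δ (π z)) ∧
    -- (4) `𝔓(C)` is acyclic: its homology is `R`, concentrated in degree 0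
    (∀ z : P, dP z = 0 → ∃ (r : R) (y : P), z = r • ι e + dP y) ∧
    (∀ r : R, (∃ y : P, r • ι e = dP y) → r = 0) ∧
    (∀ n, ∀ z ∈ grP (n + 1), dP z = 0 → ∃ y : P, z = dP y) := by
  set S := koszulSign GC.internal with hS
  set T := koszulSign hint with hT
  have hTι : ∀ x, T (ι x) = ι (S x) := by
    refine linearMap_ext_homogeneous (f := T ∘ₗ ι) (g := ι ∘ₗ S) GC.internal ?_
    intro n x hx
    simp [hS, hT, koszulSign_apply _ hx, koszulSign_apply _ (hιmem n x hx)]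
  have hTσ : ∀ x, T (σ x) = -σ (S x) := by
    refine linearMap_ext_homogeneous (f := T ∘ₗ σ) (g := -(σ ∘ₗ S)) GC.internal ?_
    rintro (_ | n) x hx
    · simp [hS, koszulSign_apply _ hx, hσzero x hx]
    · simp [hS, hT, koszulSign_apply _ hx, koszulSign_apply _ (hσmem n x hx), pow_succ]
  have hSS : ∀ x, S (S x) = x := by
    refine linearMap_ext_homogeneous (f := S ∘ₗ S) (g := LinearMap.id) GC.internal ?_
    intro n x hx
    simp [hS, koszulSign_apply _ hx, smul_smul, ← mul_pow]
  have hdS : ∀ x, GC.d (S x) = -S (GC.d x) := GC.d_koszulSign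
  have hΔS : ∀ x, Δ (S x) = TensorProduct.map S S (Δ x) := hcoalg.comul_koszulSign
  have hΔd : ∀ x, Δ (GC.d x) = TensorProduct.map GC.d LinearMap.id (Δ x)
      + TensorProduct.map S GC.d (Δ x) := hcoalg.comul_d
  have hεS : ∀ x, ε (S x) = ε x := hcoalg.counit_koszulSign
  have hΔσ' : ∀ x, ΔP (σ x) = TensorProduct.map σ ι (Δ x)
      + TensorProduct.map (ι ∘ₗ S) σ (Δ x) := by
    intro x
    obtain ⟨κ, s, a, b, deg, ha, hx⟩ := exists_homogeneous_sum GC.internal (Δ x)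
    rw [hΔσ κ s a b deg x ha hx, hx]
    exact sum_koszul GC.internal σ ι ι σ s a b deg ha
  have ext : ∀ {M : Type} [AddCommGroup M] [Module R M] {f g : P →ₗ[R] M},
      (∀ x, f (ι x) = g (ι x)) → (∀ x, f (σ x) = g (σ x)) → ∀ z, f z = g z := by
    intro M _ _ f g h1 h2 z
    obtain ⟨x, y, rfl⟩ := hsurj z
    rw [map_add, map_add, h1, h2]
  have hε : ∀ {x : C}, x ∈ GC.gr 0 → ε x = 0 → x = 0 := by
    intro x hx h0
    obtain ⟨r, rfl⟩ := Submodule.mem_span_singleton.mp (hconn.span hx)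
    have hr : r = 0 := by simpa [hconn.counit] using h0
    simp [hr]
  -- a cycle differs from the degree-zero part of `C` by an explicit boundary
  have cycle : ∀ x y : C, dP (ι x + σ y) = 0 →
      x + GC.d y ∈ GC.gr 0 ∧ ι x + σ y = ι (x + GC.d y) + dP (ι (-y)) := by
    intro x y h
    rw [map_add, hdι, hdσ] at h
    have h' : ι (GC.d x) + σ (-(x + GC.d y)) = 0 := by
      rw [← h, map_neg, map_add]; abel
    refine ⟨?_, ?_⟩
    · have := hσker _ (hindep _ _ h').2
      simpa using (GC.gr 0).neg_mem this
    · rw [hdι]; simp only [map_add, map_neg]; abel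
  have hσmem' : ∀ n, ∀ x ∈ GC.gr n, σ x ∈ grP (n + 1) := by
    rintro (_ | n) x hx
    · rw [hσzero x hx]; exact zero_mem _
    · exact hσmem n x hx
  have mem_ι : ∀ n, ∀ x ∈ GC.gr n, ΔP (ι x) ∈ tensorDeg grP grP n := by
    intro n x hx
    rw [hΔι]
    refine tensorDeg_induction (P := fun t => TensorProduct.map ι ι t ∈ tensorDeg grP grP n)
      ?_ (by simp) (fun u v hu hv => by rw [map_add]; exact add_mem hu hv) (hcoalg.deg n x hx)
    intro p q hpq a ha b hb
    exact tmul_mem_tensorDeg hpq (hιmem p a ha) (hιmem q b hb)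
  have mem_σ : ∀ n, ∀ x ∈ GC.gr n, ΔP (σ x) ∈ tensorDeg grP grP (n + 1) := by
    intro n x hx
    rw [hΔσ']
    refine tensorDeg_induction (P := fun t => TensorProduct.map σ ι t
      + TensorProduct.map (ι ∘ₗ S) σ t ∈ tensorDeg grP grP (n + 1)) ?_ (by simp) ?_
      (hcoalg.deg n x hx)
    · intro p q hpq a ha b hb
      have hSa : S a ∈ GC.gr p := by
        rw [hS, koszulSign_apply _ ha]; exact Submodule.smul_mem _ _ ha
      exact add_mem
        (tmul_mem_tensorDeg (by omega) (hσmem' p a ha) (hιmem q b hb))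
        (tmul_mem_tensorDeg (by omega) (hιmem p _ hSa) (hσmem' q b hb))
    · intro u v hu hv
      rw [map_add, map_add, add_add_add_comm]
      exact add_mem hu hv
  refine ⟨?_, ?_, ?_, ?_, ?_, ?_, ?_, ?_, ?_, ?_, ?_, ?_, ?_⟩
  · refine ext (f := dP ∘ₗ dP) (g := 0) ?_ ?_
    · intro x; simp [hdι, hdσ, GC.d_sq]
    · intro x; simp [hdσ, GC.d_sq]
  · refine ext
      (f := (TensorProduct.assoc R P P P).toLinearMap ∘ₗ TensorProduct.map ΔP LinearMap.id ∘ₗ ΔP)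
      (g := TensorProduct.map LinearMap.id ΔP ∘ₗ ΔP) ?_ ?_
    · intro x
      have hl : ∀ t : C ⊗[R] C, TensorProduct.assoc R P P P
          (TensorProduct.map ΔP LinearMap.id (TensorProduct.map ι ι t))
          = TensorProduct.map ι (TensorProduct.map ι ι)
            (TensorProduct.assoc R C C C (TensorProduct.map Δ LinearMap.id t)) := by
        intro t
        induction t using TensorProduct.induction_on with
        | zero => simp
        | tmul a b =>
          simp only [TensorProduct.map_tmul, hΔι, LinearMap.id_apply]
          generalize Δ a = u
          induction u using TensorProduct.induction_on with
          | zero => simp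
          | tmul a a' => simp
          | add u v hu hv => simp only [map_add, TensorProduct.add_tmul, hu, hv]
        | add t u ht hu => simp only [map_add, ht, hu]
      have hr : ∀ t : C ⊗[R] C,
          TensorProduct.map LinearMap.id ΔP (TensorProduct.map ι ι t)
          = TensorProduct.map ι (TensorProduct.map ι ι) (TensorProduct.map LinearMap.id Δ t) := by
        intro t
        induction t using TensorProduct.induction_on with
        | zero => simp
        | tmul a b => simp [hΔι]
        | add t u ht hu => simp only [map_add, ht, hu]
      simp only [LinearMap.comp_apply, LinearEquiv.coe_coe, hΔι]
      rw [hl, hr, hcoalg.coassoc]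
    · intro x
      let Θ : C ⊗[R] (C ⊗[R] C) →ₗ[R] P ⊗[R] (P ⊗[R] P) :=
        TensorProduct.map σ (TensorProduct.map ι ι)
          + TensorProduct.map (ι ∘ₗ S) (TensorProduct.map σ ι)
          + TensorProduct.map (ι ∘ₗ S) (TensorProduct.map (ι ∘ₗ S) σ)
      have hl : ∀ t : C ⊗[R] C, TensorProduct.assoc R P P P
          (TensorProduct.map ΔP LinearMap.id
            (TensorProduct.map σ ι t + TensorProduct.map (ι ∘ₗ S) σ t))
          = Θ (TensorProduct.assoc R C C C (TensorProduct.map Δ LinearMap.id t)) := by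
        intro t
        induction t using TensorProduct.induction_on with
        | zero => simp
        | tmul a b =>
          simp only [map_add, TensorProduct.map_tmul, hΔσ', hΔι, hΔS, LinearMap.comp_apply,
            LinearMap.id_apply]
          generalize Δ a = u
          induction u using TensorProduct.induction_on with
          | zero => simp
          | tmul a a' => simp [Θ, TensorProduct.add_tmul]
          | add u v hu hv =>
            simp only [map_add, TensorProduct.add_tmul] at hu hv ⊢
            rw [← hu, ← hv]
            abel
        | add t u ht hu =>
          simp only [map_add] at ht hu ⊢
          rw [← ht, ← hu]
          abel
      have hr : ∀ t : C ⊗[R] C, TensorProduct.map LinearMap.id ΔP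
            (TensorProduct.map σ ι t + TensorProduct.map (ι ∘ₗ S) σ t)
          = Θ (TensorProduct.map LinearMap.id Δ t) := by
        intro t
        induction t using TensorProduct.induction_on with
        | zero => simp
        | tmul a b => simp [Θ, hΔσ', hΔι, TensorProduct.tmul_add, add_assoc]
        | add t u ht hu =>
          simp only [map_add] at ht hu ⊢
          rw [← ht, ← hu]
          abel
      simp only [LinearMap.comp_apply, LinearEquiv.coe_coe, hΔσ']
      rw [hl, hr, hcoalg.coassoc]
  · refine ext (f := (TensorProduct.lid R P).toLinearMap ∘ₗ
      TensorProduct.map (ε ∘ₗ π) LinearMap.id ∘ₗ ΔP) (g := LinearMap.id) ?_ ?_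
    · intro x
      simp only [LinearMap.comp_apply, LinearEquiv.coe_coe, hΔι, LinearMap.id_apply]
      conv_rhs => rw [← hcoalg.counit_l x]
      generalize Δ x = t
      induction t using TensorProduct.induction_on with
      | zero => simp
      | tmul a b => simp [hπι]
      | add t u ht hu => simp only [map_add, ht, hu]
    · intro x
      simp only [LinearMap.comp_apply, LinearEquiv.coe_coe, hΔσ', LinearMap.id_apply]
      conv_rhs => rw [← hcoalg.counit_l x]
      generalize Δ x = t
      induction t using TensorProduct.induction_on with
      | zero => simp
      | tmul a b => simp [hπι, hπσ, hεS]
      | add t u ht hu =>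
        simp only [map_add] at ht hu ⊢
        rw [← ht, ← hu]
        abel
  · refine ext (f := (TensorProduct.rid R P).toLinearMap ∘ₗ
      TensorProduct.map LinearMap.id (ε ∘ₗ π) ∘ₗ ΔP) (g := LinearMap.id) ?_ ?_
    · intro x
      simp only [LinearMap.comp_apply, LinearEquiv.coe_coe, hΔι, LinearMap.id_apply]
      conv_rhs => rw [← hcoalg.counit_r x]
      generalize Δ x = t
      induction t using TensorProduct.induction_on with
      | zero => simp
      | tmul a b => simp [hπι]
      | add t u ht hu => simp only [map_add, ht, hu]
    · intro x
      simp only [LinearMap.comp_apply, LinearEquiv.coe_coe, hΔσ', LinearMap.id_apply]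
      conv_rhs => rw [← hcoalg.counit_r x]
      generalize Δ x = t
      induction t using TensorProduct.induction_on with
      | zero => simp
      | tmul a b => simp [hπι, hπσ]
      | add t u ht hu =>
        simp only [map_add] at ht hu ⊢
        rw [← ht, ← hu]
        abel
  · rintro (_ | n) z hz
    · obtain ⟨x, hx, rfl⟩ := hsurj0 z hz
      exact mem_ι 0 x hx
    · obtain ⟨x, y, hx, hy, rfl⟩ := hsurjn n z hz
      rw [map_add]
      exact add_mem (mem_ι _ x hx) (mem_σ n y hy)
  · intro κ s a b deg z ha hz
    refine Eq.trans ?_ (sum_koszul hint dP LinearMap.id LinearMap.id dP s a b deg ha).symm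
    rw [← hz, ← hT, LinearMap.id_comp]
    refine ext (f := ΔP ∘ₗ dP) (g := TensorProduct.map dP LinearMap.id ∘ₗ ΔP
      + TensorProduct.map T dP ∘ₗ ΔP) ?_ ?_ z
    · intro x
      simp only [LinearMap.comp_apply, LinearMap.add_apply, hdι, map_sub, hΔι, hΔσ', hΔd]
      generalize Δ x = t
      induction t using TensorProduct.induction_on with
      | zero => simp
      | tmul a b =>
        simp only [map_add, TensorProduct.map_tmul, LinearMap.comp_apply, LinearMap.id_apply,
          hdι, hTι, TensorProduct.sub_tmul, TensorProduct.tmul_sub]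
        abel
      | add t u ht hu =>
        simp only [map_add] at ht hu ⊢
        calc _ = _ + _ := by abel
          _ = _ := congrArg₂ (· + ·) ht hu
          _ = _ := by abel
    · intro x
      simp only [LinearMap.comp_apply, LinearMap.add_apply, hdσ, map_neg, hΔσ', hΔd]
      generalize Δ x = t
      induction t using TensorProduct.induction_on with
      | zero => simp
      | tmul a b =>
        simp only [map_add, TensorProduct.map_tmul, LinearMap.comp_apply, LinearMap.id_apply,
          hdι, hdσ, hTι, hTσ, hSS, hdS, map_neg, TensorProduct.sub_tmul, TensorProduct.tmul_sub,
          TensorProduct.neg_tmul, TensorProduct.tmul_neg]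
        abel
      | add t u ht hu =>
        simp only [map_add] at ht hu ⊢
        calc _ = _ + _ := by abel
          _ = _ := congrArg₂ (· + ·) ht hu
          _ = _ := by abel
  · intro z hz
    obtain ⟨x, hx, rfl⟩ := hsurj0 z hz
    obtain ⟨r, rfl⟩ := Submodule.mem_span_singleton.mp (hconn.span hx)
    exact Submodule.mem_span_singleton.mpr ⟨r, by simp⟩
  · exact fun x => ⟨ι x, hπι x⟩
  · refine ext (f := π ∘ₗ dP) (g := GC.d ∘ₗ π) ?_ ?_
    · intro x; simp [hdι, hπι, hπσ]
    · intro x; simp [hdσ, hπσ]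
  · refine ext (f := TensorProduct.map π π ∘ₗ ΔP) (g := Δ ∘ₗ π) ?_ ?_
    · intro x
      simp only [LinearMap.comp_apply, hΔι, hπι]
      generalize Δ x = t
      induction t using TensorProduct.induction_on with
      | zero => simp
      | tmul a b => simp [hπι]
      | add t u ht hu => simp only [map_add, ht, hu]
    · intro x
      simp only [LinearMap.comp_apply, hΔσ', hπσ, map_zero]
      generalize Δ x = t
      induction t using TensorProduct.induction_on with
      | zero => simp
      | tmul a b => simp [hπσ]
      | add t u ht hu =>
        simp only [map_add] at ht hu ⊢
        rw [add_add_add_comm, ht, hu, add_zero]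
  · intro z hz
    obtain ⟨x, y, rfl⟩ := hsurj z
    obtain ⟨h0, h1⟩ := cycle x y hz
    obtain ⟨r, hr⟩ := Submodule.mem_span_singleton.mp (hconn.span h0)
    exact ⟨r, ι (-y), by rw [h1, ← hr, map_smul]⟩
  · rintro r ⟨y, hy⟩
    obtain ⟨a, b, rfl⟩ := hsurj y
    rw [map_add, hdι, hdσ] at hy
    have h1 : ι (GC.d a - r • e) + σ (-(a + GC.d b)) = 0 := by
      simp only [map_sub, map_smul, map_neg, map_add, hy]; abel
    have h2 := sub_eq_zero.mp (hιinj _ (hindep _ _ h1).1)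
    apply hconn.faithful
    have h3 := GC.d_zero _ (hσker _ (hindep _ _ h1).2)
    simpa [GC.d_sq, ← h2] using h3
  · intro n z hz hd
    obtain ⟨x, y, hx, -, rfl⟩ := hsurjn n z hz
    obtain ⟨h0, h1⟩ := cycle x y hd
    have h2 : x + GC.d y = 0 :=
      hε h0 (by rw [map_add, hcoalg.counit_eq_zero hx, hcoalg.counit_d, add_zero])
    exact ⟨ι (-y), by rw [h1, h2, map_zero, zero_add]⟩

end Stmt5
end

section
/- Let p : H' → H be a surjective morphism of connected chain Hopf algebras over R whose underlying graded R-modules are free, and let ν := (1 ⊗ p) ∘ Δ' : H' → H' ⊗ H be the induced right H-comodule structure on H'. Suppose p admits a section s : H → H' that is a morphism of graded Hopf algebras (multiplicative, comultiplicative, unital and counital, but not required to commute with the differentials). Then: (1) B := H' □_H R = {x ∈ H' : ν(x) = x ⊗ 1} is a sub chain algebra of H'; (2) the map h := μ' ∘ (i ⊗ s) : B ⊗ H → H', where i : B → H' is the inclusion and μ' is the multiplication of H', is an isomorphism of graded right H-comodules and of graded left B-modules (so H' is cofree as a nondifferential right H-comodule with cobasis B); and (3) the transported differential h⁻¹ ∘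 d' ∘ h on B ⊗ H restricts on B ⊗ 1 to d_B ⊗ 1, where d_B is the restriction of d' to B. -/
/-!
Statement 11: a surjection of connected chain Hopf algebras with a (nondifferential) Hopf section is cofree over its target, with cobasis the cotensor sub chain algebra.
compatible chain algebra morphism `g : B → B'` induces a morphism of chain algebras
`Ωf ⊗ g : ΩH ⊗_{tΩ} B → ΩH' ⊗_{tΩ} B'`, functorially.
-/

open scoped TensorProduct

namespace Stmt11

/-- A non-negatively graded chain complex structure on an `R`-module `A`. -/
structure GradedChain (R A : Type) [CommRing R] [AddCommGroup A] [Module R A] where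
  gr : ℕ → Submodule R A
  internal : DirectSum.IsInternal gr
  free : ∀ n, Module.Free R (gr n)
  d : A →ₗ[R] A
  d_mem : ∀ n, ∀ x ∈ gr (n + 1), d x ∈ gr n
  d_zero : ∀ x ∈ gr 0, d x = 0
  d_sq : ∀ x, d (d x) = 0

variable {R A : Type} [CommRing R]

/-- Chain algebra laws. -/
structure ChainAlgLaws [Ring A] [Algebra R A] (G : GradedChain R A) : Prop where
  one_mem : (1 : A) ∈ G.gr 0
  mul_mem : ∀ i j (x y : A), x ∈ G.gr i → y ∈ G.gr j → x * y ∈ G.gr (i + j)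
  leibniz : ∀ i (x y : A), x ∈ G.gr i →
    G.d (x * y) = G.d x * y + ((-1 : ℤ) ^ i) • (x * G.d y)

variable {B : Type}

/-- The submodule of `A ⊗ B` generated by tensors of elements of `P` and `Q`. -/
noncomputable def tensorPiece [AddCommGroup A] [Module R A] [AddCommGroup B] [Module R B]
    (P : Submodule R A) (Q : Submodule R B) : Submodule R (A ⊗[R] B) :=
  LinearMap.range (TensorProduct.map P.subtype Q.subtype)

/-- The degree-`n` part of the tensor product of two graded modules. -/
noncomputable def tensorDeg [AddCommGroup A] [Module R A] [AddCommGroup B] [Module R B]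
    (gr : ℕ → Submodule R A) (gr' : ℕ → Submodule R B) (n : ℕ) :
    Submodule R (A ⊗[R] B) :=
  ⨆ p : {p : ℕ × ℕ // p.1 + p.2 = n}, tensorPiece (gr p.1.1) (gr' p.1.2)

/-- Chain coalgebra laws for `(Δ, ε)` on the graded chain complex `G`. -/
structure ChainCoalgLaws [AddCommGroup A] [Module R A] (G : GradedChain R A)
    (Δ : A →ₗ[R] A ⊗[R] A) (ε : A →ₗ[R] R) : Prop where
  coassoc : ∀ x, (TensorProduct.assoc R A A A) ((TensorProduct.map Δ LinearMap.id) (Δ x))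
      = (TensorProduct.map LinearMap.id Δ) (Δ x)
  counit_l : ∀ x, (TensorProduct.lid R A) ((TensorProduct.map ε LinearMap.id) (Δ x)) = x
  counit_r : ∀ x, (TensorProduct.rid R A) ((TensorProduct.map LinearMap.id ε) (Δ x)) = x
  deg : ∀ n, ∀ x ∈ G.gr n, Δ x ∈ tensorDeg G.gr G.gr n
  chain : ∀ (ι : Type) (s : Finset ι) (a b : ι → A) (da : ι → ℕ) (x : A),
    (∀ i ∈ s, a i ∈ G.gr (da i)) →
    Δ x = ∑ i ∈ s, a i ⊗ₜ[R] b i →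
    Δ (G.d x) = ∑ i ∈ s, (G.d (a i) ⊗ₜ[R] b i + ((-1 : ℤ) ^ (da i)) • (a i ⊗ₜ[R] G.d (b i)))

/-- Chain Hopf algebra compatibility laws (Koszul-signed product on `A ⊗ A`). -/
structure HopfLaws [Ring A] [Algebra R A] (G : GradedChain R A)
    (Δ : A →ₗ[R] A ⊗[R] A) (ε : A →ₗ[R] R) : Prop where
  delta_one : Δ (1 : A) = (1 : A) ⊗ₜ[R] (1 : A)
  eps_one : ε (1 : A) = 1
  delta_mul : ∀ (ι ι' : Type) (s : Finset ι) (s' : Finset ι')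
    (a b : ι → A) (db : ι → ℕ) (a' b' : ι' → A) (da' : ι' → ℕ) (x y : A),
    (∀ i ∈ s, b i ∈ G.gr (db i)) → (∀ j ∈ s', a' j ∈ G.gr (da' j)) →
    Δ x = ∑ i ∈ s, a i ⊗ₜ[R] b i → Δ y = ∑ j ∈ s', a' j ⊗ₜ[R] b' j →
    Δ (x * y) = ∑ i ∈ s, ∑ j ∈ s',
      ((-1 : ℤ) ^ (db i * da' j)) • ((a i * a' j) ⊗ₜ[R] (b i * b' j))

/-- Connectedness: the degree-0 part is spanned by the unit, faithfully. -/
def Connected [Ring A] [Algebra R A] (G : GradedChain R A) : Prop :=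
  G.gr 0 ≤ Submodule.span R {(1 : A)} ∧ ∀ r : R, r • (1 : A) = 0 → r = 0

section Morphisms

variable {H H' : Type} [Ring H] [Algebra R H] [Ring H'] [Algebra R H']

/-- A morphism of chain Hopf algebras. -/
structure HopfMorLaws (GH : GradedChain R H) (Δ : H →ₗ[R] H ⊗[R] H) (ε : H →ₗ[R] R)
    (GH' : GradedChain R H') (Δ' : H' →ₗ[R] H' ⊗[R] H') (ε' : H' →ₗ[R] R)
    (f : H →ₐ[R] H') : Prop where
  chain : ∀ x, f (GH.d x) = GH'.d (f x)
  deg : ∀ n, ∀ x ∈ GH.gr n, f x ∈ GH'.gr n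
  comul : ∀ x, (TensorProduct.map f.toLinearMap f.toLinearMap) (Δ x) = Δ' (f x)
  counit : ∀ x, ε' (f x) = ε x

/-- A morphism of graded Hopf algebras (not required to commute with the
differentials). -/
structure GradedHopfMorLaws (GH : GradedChain R H) (Δ : H →ₗ[R] H ⊗[R] H)
    (ε : H →ₗ[R] R) (GH' : GradedChain R H') (Δ' : H' →ₗ[R] H' ⊗[R] H')
    (ε' : H' →ₗ[R] R) (f : H →ₐ[R] H') : Prop where
  deg : ∀ n, ∀ x ∈ GH.gr n, f x ∈ GH'.gr n
  comul : ∀ x, (TensorProduct.map f.toLinearMap f.toLinearMap) (Δ x) = Δ' (f x)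
  counit : ∀ x, ε' (f x) = ε x

end Morphisms

section GradedModules

open DirectSum

variable {M : Type} [AddCommGroup A] [Module R A] [AddCommGroup M] [Module R M]
  [AddCommGroup B] [Module R B]

/-- A family of linear maps glues along the homogeneous components of a graded module. -/
theorem exists_linearMap_eq_on_homogeneous {gr : ℕ → Submodule R A}
    (hgr : DirectSum.IsInternal gr) (f : ℕ → A →ₗ[R] M) :
    ∃ F : A →ₗ[R] M, ∀ n, ∀ x ∈ gr n, F x = f n x := by
  let _ := hgr.chooseDecomposition
  refine ⟨DirectSum.toModule R ℕ M (fun n => f n ∘ₗ (gr n).subtype) ∘ₗ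
    (decomposeLinearEquiv gr).toLinearMap, fun n x hx => ?_⟩
  change DirectSum.toModule R ℕ M _ (decompose gr x) = _
  rw [decompose_of_mem gr hx, ← DirectSum.lof_eq_of R, DirectSum.toModule_lof]
  rfl

/-- Linear maps that agree on homogeneous elements are equal. -/
theorem linearMap_ext_of_homogeneous {gr : ℕ → Submodule R A}
    (hgr : DirectSum.IsInternal gr) {f g : A →ₗ[R] M}
    (h : ∀ n, ∀ x ∈ gr n, f x = g x) : f = g := by
  let _ := hgr.chooseDecomposition
  exact decompose_lhom_ext gr fun n => LinearMap.ext fun x => h n x x.2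

/-- A tensor is a finite sum of pure tensors with homogeneous right factors. -/
theorem exists_sum_tmul_homogeneous_right {gr : ℕ → Submodule R B}
    (hgr : DirectSum.IsInternal gr) (z : A ⊗[R] B) :
    ∃ (ι : Type) (t : Finset ι) (a : ι → A) (b : ι → B) (db : ι → ℕ),
      (∀ i, b i ∈ gr (db i)) ∧ z = ∑ i ∈ t, a i ⊗ₜ[R] b i := by
  classical
  let _ := hgr.chooseDecomposition
  obtain ⟨S, rfl⟩ := TensorProduct.exists_finset z
  refine ⟨Σ _ : A × B, ℕ, S.sigma fun q => (decompose gr q.2).support, fun i => i.1.1,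
    fun i => decompose gr i.1.2 i.2, fun i => i.2, fun i => SetLike.coe_mem _, ?_⟩
  rw [Finset.sum_sigma]
  refine Finset.sum_congr rfl fun q _ => ?_
  exact (congrArg (q.1 ⊗ₜ[R] ·) (sum_support_decompose gr q.2)).symm.trans
    (TensorProduct.tmul_sum _ _ _)

/-- A tensor is a finite sum of pure tensors with homogeneous left factors. -/
theorem exists_sum_tmul_homogeneous_left {gr : ℕ → Submodule R A}
    (hgr : DirectSum.IsInternal gr) (z : A ⊗[R] B) :
    ∃ (ι : Type) (t : Finset ι) (a : ι → A) (b : ι → B) (da : ι → ℕ),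
      (∀ i, a i ∈ gr (da i)) ∧ z = ∑ i ∈ t, a i ⊗ₜ[R] b i := by
  obtain ⟨ι, t, b, a, da, ha, hz⟩ :=
    exists_sum_tmul_homogeneous_right hgr (TensorProduct.comm R A B z)
  refine ⟨ι, t, a, b, da, ha, ?_⟩
  apply (TensorProduct.comm R A B).injective
  simp [hz]

end GradedModules

section Antipode

open WithConv Coalgebra

variable {C : Type} [AddCommGroup C] [Module R C] [Coalgebra R C] [Ring A] [Algebra R A]
  {gr : ℕ → Submodule R C}

/-- A convolution product vanishes in degree `n` if all products of values on homogeneous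
elements of complementary degrees do. -/
theorem convMul_eq_zero_of_homogeneous {f g : WithConv (C →ₗ[R] A)} {n : ℕ} {x : C}
    (hx : comul (R := R) x ∈ tensorDeg gr gr n)
    (h : ∀ i j, i + j = n → ∀ a ∈ gr i, ∀ b ∈ gr j, f a * g b = 0) : (f * g) x = 0 := by
  have hle : tensorDeg gr gr n ≤
      LinearMap.ker (LinearMap.mul' R A ∘ₗ TensorProduct.map f.ofConv g.ofConv) := by
    refine iSup_le fun q => ?_
    rintro _ ⟨z, rfl⟩
    induction z using TensorProduct.induction_on with
    | zero => simp
    | add z w hz hw => rw [map_add]; exact add_mem hz hw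
    | tmul a b => simpa using h _ _ q.2 a a.2 b b.2
  simpa using hle hx

/-- Convolution powers of a map vanishing in degree `0` vanish in small degrees. -/
theorem convPow_eq_zero_of_lt (hdeg : ∀ n, ∀ x ∈ gr n, comul (R := R) x ∈ tensorDeg gr gr n)
    {f : WithConv (C →ₗ[R] A)} (hf : ∀ x ∈ gr 0, f x = 0) (n : ℕ) :
    ∀ m < n, ∀ x ∈ gr m, (f ^ n) x = 0 := by
  induction n with
  | zero => simp
  | succ n ih =>
    intro m hm x hx
    rw [pow_succ']
    refine convMul_eq_zero_of_homogeneous (hdeg m x hx) fun i j hij a ha b hb => ?_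
    rcases Nat.eq_zero_or_pos i with rfl | hi
    · rw [hf a ha, zero_mul]
    · rw [ih j (by omega) b hb, mul_zero]

/-- A linear map which agrees with the convolution unit in degree `0` is convolution
invertible. -/
theorem exists_convInverse (hgr : DirectSum.IsInternal gr)
    (hdeg : ∀ n, ∀ x ∈ gr n, comul (R := R) x ∈ tensorDeg gr gr n)
    (f : WithConv (C →ₗ[R] A)) (hf : ∀ x ∈ gr 0, f x = (1 : WithConv (C →ₗ[R] A)) x) :
    ∃ S : WithConv (C →ₗ[R] A), f * S = 1 ∧ S * f = 1 := by
  set g : WithConv (C →ₗ[R] A) := 1 - f with hg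
  have hpow := convPow_eq_zero_of_lt hdeg (f := g) fun x hx => by
    simp [hg, hf x hx]
  let T : ℕ → WithConv (C →ₗ[R] A) := fun n => ∑ k ∈ Finset.range (n + 1), g ^ k
  obtain ⟨S, hS⟩ := exists_linearMap_eq_on_homogeneous hgr fun n => (T n).ofConv
  have hST : ∀ N, ∀ n ≤ N, ∀ x ∈ gr n, (toConv S - T N) x = 0 := by
    intro N n hn x hx
    have hT : T N = T n + ∑ k ∈ Finset.Ico (n + 1) (N + 1), g ^ k :=
      (Finset.sum_range_add_sum_Ico _ (by omega)).symm
    have h0 : (∑ k ∈ Finset.Ico (n + 1) (N + 1), g ^ k) x = 0 := by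
      rw [WithConv.ofConv_sum, LinearMap.sum_apply]
      refine Finset.sum_eq_zero fun k hk => hpow k n ?_ x hx
      have := Finset.mem_Ico.1 hk
      omega
    rw [hT]
    rw [ofConv_sub, LinearMap.sub_apply, ofConv_add, LinearMap.add_apply, h0, add_zero]
    exact sub_eq_zero.2 (hS n x hx)
  have hfg : f = 1 - g := by simp [hg]
  refine ⟨toConv S, WithConv.ext (linearMap_ext_of_homogeneous hgr fun n x hx => ?_),
    WithConv.ext (linearMap_ext_of_homogeneous hgr fun n x hx => ?_)⟩
  · have h1 : (f * (toConv S - T n)) x = 0 :=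
      convMul_eq_zero_of_homogeneous (hdeg n x hx) fun i j hij a _ b hb => by
        rw [hST n j (by omega) b hb, mul_zero]
    have h2 : f * toConv S = f * (toConv S - T n) + (1 - g ^ (n + 1)) := by
      rw [mul_sub, hfg, mul_neg_geom_sum, sub_add_cancel]
    have h3 : (g ^ (n + 1)) x = 0 := hpow (n + 1) n (Nat.lt_succ_self n) x hx
    rw [h2, ofConv_add, LinearMap.add_apply, h1, ofConv_sub, LinearMap.sub_apply, h3, sub_zero,
      zero_add]
  · have h1 : ((toConv S - T n) * f) x = 0 :=
      convMul_eq_zero_of_homogeneous (hdeg n x hx) fun i j hij a ha b _ => by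
        rw [hST n i (by omega) a ha, zero_mul]
    have h2 : toConv S * f = (toConv S - T n) * f + (1 - g ^ (n + 1)) := by
      rw [sub_mul, hfg, geom_sum_mul_neg, sub_add_cancel]
    have h3 : (g ^ (n + 1)) x = 0 := hpow (n + 1) n (Nat.lt_succ_self n) x hx
    rw [h2, ofConv_add, LinearMap.add_apply, h1, ofConv_sub, LinearMap.sub_apply, h3, sub_zero,
      zero_add]

end Antipode

section HopfModule

open WithConv Coalgebra

variable {H H' : Type} [Ring H] [Algebra R H] [Ring H'] [Algebra R H'] [Coalgebra R H']
  [Ring A] [Algebra R A]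

/-- Algebra morphisms preserve convolution identities `f * g = 1`. -/
theorem algHom_comp_convMul_eq_one (φ : H →ₐ[R] A) {f g : WithConv (H' →ₗ[R] H)}
    (h : f * g = 1) :
    toConv (φ.toLinearMap ∘ₗ f.ofConv) * toConv (φ.toLinearMap ∘ₗ g.ofConv) = 1 := by
  apply WithConv.ofConv_injective
  rw [← LinearMap.algHom_comp_convMul_distrib, h]
  ext x
  simp

variable [Coalgebra R H]

/-- Precomposition with a coalgebra morphism preserves the convolution unit. -/
theorem convOne_comp_coalgHom (q : H' →ₗc[R] H) :
    (1 : WithConv (H →ₗ[R] A)).ofConv ∘ₗ q.toLinearMap = (1 : WithConv (H' →ₗ[R] A)).ofConv := by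
  ext x
  simp

/-- The coinvariant projection `x ↦ ∑ x₁ · s (S (p x₂))`. -/
noncomputable def coinvariantProj (S : H →ₗ[R] H) (p : H' →ₐc[R] H) (s : H →ₐc[R] H') :
    WithConv (H' →ₗ[R] H') :=
  toConv LinearMap.id *
    toConv ((s : H →ₐ[R] H').toLinearMap ∘ₗ S ∘ₗ (p : H' →ₗc[R] H).toLinearMap)

/-- The coinvariant projection equalizes the coaction `N` and `x ↦ x ⊗ 1`, for every
factorization `N = j * (k ∘ p)` through algebra morphisms. -/
theorem coaction_comp_coinvariantProj {S : H →ₗ[R] H}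
    (hidS : toConv LinearMap.id * toConv S = 1) (hSid : toConv S * toConv LinearMap.id = 1)
    (p : H' →ₐc[R] H) (s : H →ₐc[R] H') (hps : ∀ x, p (s x) = x)
    (N j : H' →ₐ[R] A) (k : H →ₗ[R] A)
    (hN : toConv N.toLinearMap = toConv j.toLinearMap *
      toConv (k ∘ₗ (p : H' →ₗc[R] H).toLinearMap)) (x : H') :
    N (coinvariantProj S p s x) = j (coinvariantProj S p s x) := by
  let sl : H →ₐ[R] H' := s
  have hNs : toConv (N.toLinearMap ∘ₗ sl.toLinearMap) =
      toConv (j.toLinearMap ∘ₗ sl.toLinearMap) * toConv k := by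
    have := LinearMap.convMul_comp_coalgHom_distrib (toConv j.toLinearMap)
      (toConv (k ∘ₗ (p : H' →ₗc[R] H).toLinearMap)) (s : H →ₗc[R] H')
    rw [← hN] at this
    have hk : (k ∘ₗ (p : H' →ₗc[R] H).toLinearMap) ∘ₗ (s : H →ₗc[R] H').toLinearMap = k :=
      LinearMap.ext fun w => congrArg k (hps w)
    apply WithConv.ofConv_injective
    rw [hk] at this
    exact this
  have hn := algHom_comp_convMul_eq_one (N.comp sl) hidS
  have hj := algHom_comp_convMul_eq_one (j.comp sl) hSid
  have hk : toConv k * toConv (N.toLinearMap ∘ₗ sl.toLinearMap ∘ₗ S) =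
      toConv (j.toLinearMap ∘ₗ sl.toLinearMap ∘ₗ S) := by
    change toConv (N.toLinearMap ∘ₗ sl.toLinearMap) *
      toConv (N.toLinearMap ∘ₗ sl.toLinearMap ∘ₗ S) = 1 at hn
    change toConv (j.toLinearMap ∘ₗ sl.toLinearMap ∘ₗ S) *
      toConv (j.toLinearMap ∘ₗ sl.toLinearMap) = 1 at hj
    rw [hNs, mul_assoc] at hn
    exact (left_inv_eq_right_inv hj hn).symm
  have hkp := LinearMap.convMul_comp_coalgHom_distrib (toConv k)
    (toConv (N.toLinearMap ∘ₗ sl.toLinearMap ∘ₗ S)) (p : H' →ₗc[R] H)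
  rw [hk] at hkp
  have hNP := LinearMap.algHom_comp_convMul_distrib N (toConv LinearMap.id)
    (toConv (sl.toLinearMap ∘ₗ S ∘ₗ (p : H' →ₗc[R] H).toLinearMap))
  have hjP := LinearMap.algHom_comp_convMul_distrib j (toConv LinearMap.id)
    (toConv (sl.toLinearMap ∘ₗ S ∘ₗ (p : H' →ₗc[R] H).toLinearMap))
  refine LinearMap.congr_fun (hNP.trans (Eq.trans ?_ hjP.symm)) x
  congr 1
  change toConv N.toLinearMap * toConv ((N.toLinearMap ∘ₗ sl.toLinearMap ∘ₗ S) ∘ₗ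
    (p : H' →ₗc[R] H).toLinearMap) = toConv j.toLinearMap *
      toConv ((j.toLinearMap ∘ₗ sl.toLinearMap ∘ₗ S) ∘ₗ (p : H' →ₗc[R] H).toLinearMap)
  rw [hN, mul_assoc]
  congr 1
  exact WithConv.ofConv_injective hkp.symm

/-- The map `b ⊗ w ↦ b · s w` from the cofree comodule is a bijection as soon as it is a
comodule map and the coinvariant projection takes values in `Bsub`. -/
theorem bijective_of_coinvariantProj_mem {S : H →ₗ[R] H}
    (hidS : toConv LinearMap.id * toConv S = 1) (hSid : toConv S * toConv LinearMap.id = 1)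
    (p : H' →ₐc[R] H) (s : H →ₐc[R] H') {Bsub : Submodule R H'}
    (hP : ∀ x, coinvariantProj S p s x ∈ Bsub) (h : Bsub ⊗[R] H →ₗ[R] H')
    (hh : ∀ (x : Bsub) (w : H), h (x ⊗ₜ[R] w) = (x : H') * s w)
    (hν : ∀ z : Bsub ⊗[R] H,
      TensorProduct.map LinearMap.id (p : H' →ₐ[R] H).toLinearMap (comul (R := R) (h z)) =
        TensorProduct.map h LinearMap.id ((TensorProduct.assoc R Bsub H H).symm
          (TensorProduct.map LinearMap.id (comul (R := R)) z))) :
    Function.Bijective h := by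
  let ν : H' →ₗ[R] H' ⊗[R] H :=
    TensorProduct.map LinearMap.id (p : H' →ₐ[R] H).toLinearMap ∘ₗ comul
  let P : H' →ₗ[R] Bsub := (coinvariantProj S p s).ofConv.codRestrict Bsub hP
  let φ : H' →ₗ[R] Bsub ⊗[R] H := TensorProduct.map P LinearMap.id ∘ₗ ν
  have hPν : ∀ x, (P x : H') = LinearMap.mul' R H'
      (TensorProduct.map LinearMap.id ((s : H →ₐ[R] H').toLinearMap ∘ₗ S) (ν x)) := by
    intro x
    change LinearMap.mul' R H' (TensorProduct.map _ _ (comul (R := R) x)) = _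
    simp only [ν, LinearMap.comp_apply]
    rw [TensorProduct.map_map]
    rfl
  have hPh : ∀ (b : Bsub) (w : H), P (h (b ⊗ₜ[R] w)) = counit (R := R) w • b := by
    intro b w
    have key : ∀ t : H ⊗[R] H, LinearMap.mul' R H'
        (TensorProduct.map LinearMap.id ((s : H →ₐ[R] H').toLinearMap ∘ₗ S)
          (TensorProduct.map h LinearMap.id
            ((TensorProduct.assoc R Bsub H H).symm (b ⊗ₜ[R] t)))) =
        b * s (LinearMap.mul' R H (TensorProduct.map LinearMap.id S t)) := by
      intro t
      induction t using TensorProduct.induction_on with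
      | zero => simp
      | add t u ht hu => simp only [TensorProduct.tmul_add, map_add, ht, hu, mul_add]
      | tmul u v => simp [hh, mul_assoc]
    have hS : LinearMap.mul' R H (TensorProduct.map LinearMap.id S (comul (R := R) w)) =
        algebraMap R H (counit (R := R) w) :=
      LinearMap.congr_fun (congrArg ofConv hidS) w
    apply Subtype.ext
    rw [hPν]
    change LinearMap.mul' R H' (TensorProduct.map _ _ (TensorProduct.map LinearMap.id
      (p : H' →ₐ[R] H).toLinearMap (comul (R := R) (h (b ⊗ₜ[R] w))))) = _
    rw [hν, TensorProduct.map_tmul, LinearMap.id_apply, key, hS, Algebra.algebraMap_eq_smul_one,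
      map_smul, map_one, mul_smul_comm, mul_one, Submodule.coe_smul]
  have hleft : φ ∘ₗ h = LinearMap.id := by
    refine TensorProduct.ext' fun b w => ?_
    have key : ∀ t : H ⊗[R] H, TensorProduct.map P LinearMap.id
        (TensorProduct.map h LinearMap.id
          ((TensorProduct.assoc R Bsub H H).symm (b ⊗ₜ[R] t))) =
        b ⊗ₜ[R] TensorProduct.lid R H (LinearMap.rTensor H (counit (R := R)) t) := by
      intro t
      induction t using TensorProduct.induction_on with
      | zero => simp
      | add t u ht hu => simp only [TensorProduct.tmul_add, map_add, ht, hu]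
      | tmul u v => simp [hPh, TensorProduct.smul_tmul]
    change TensorProduct.map P LinearMap.id (TensorProduct.map LinearMap.id
      (p : H' →ₐ[R] H).toLinearMap (comul (R := R) (h (b ⊗ₜ[R] w)))) = _
    rw [hν, TensorProduct.map_tmul, LinearMap.id_apply, key, rTensor_counit_comul]
    simp
  have hright : ∀ x, h (φ x) = x := by
    intro x
    have key : ∀ t : H' ⊗[R] H, h (TensorProduct.map P LinearMap.id t) =
        LinearMap.mul' R H' (TensorProduct.map (coinvariantProj S p s).ofConv
          (s : H →ₐ[R] H').toLinearMap t) := by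
      intro t
      induction t using TensorProduct.induction_on with
      | zero => simp
      | add t u ht hu => simp only [map_add, ht, hu]
      | tmul u v => simp [hh, P]
    have hsS := algHom_comp_convMul_eq_one (s : H →ₐ[R] H') hSid
    have hsSp := LinearMap.convMul_comp_coalgHom_distrib
      (toConv ((s : H →ₐ[R] H').toLinearMap ∘ₗ S)) (toConv (s : H →ₐ[R] H').toLinearMap)
      (p : H' →ₗc[R] H)
    have hP1 : coinvariantProj S p s *
        toConv ((s : H →ₐ[R] H').toLinearMap ∘ₗ (p : H' →ₗc[R] H).toLinearMap) =
          toConv LinearMap.id := by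
      rw [coinvariantProj, mul_assoc]
      refine (congrArg (toConv LinearMap.id * ·) ?_).trans (mul_one _)
      apply WithConv.ofConv_injective
      refine hsSp.symm.trans ((congrArg (fun f => f.ofConv ∘ₗ _) hsS).trans ?_)
      exact convOne_comp_coalgHom (p : H' →ₗc[R] H)
    change h (TensorProduct.map P LinearMap.id (ν x)) = x
    rw [key]
    simp only [ν, LinearMap.comp_apply]
    rw [TensorProduct.map_map]
    exact LinearMap.congr_fun (congrArg ofConv hP1) x
  exact ⟨Function.LeftInverse.injective (g := φ) fun z => LinearMap.congr_fun hleft z,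
    Function.RightInverse.surjective hright⟩

end HopfModule

section GradedTensor

open GradedTensorProduct

variable {H H' : Type} [Ring H'] [Algebra R H'] [Ring H] [Algebra R H]

/-- The graded algebra structure underlying a chain algebra. -/
@[reducible]
noncomputable def ChainAlgLaws.gradedAlgebra {G : GradedChain R H} (hG : ChainAlgLaws G) :
    GradedAlgebra G.gr :=
  { G.internal.chooseDecomposition with
    one_mem := hG.one_mem
    mul_mem := fun {i j x y} hx hy => hG.mul_mem i j x y hx hy }

/-- Left multiplication by `a ⊗ 1` in a graded tensor product carries no sign. -/
theorem tmul_one_mul_tmul (𝒜 : ℕ → Submodule R H') (ℬ : ℕ → Submodule R H) [GradedAlgebra 𝒜]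
    [GradedAlgebra ℬ] (a a' : H') (c : H) :
    (a ᵍ⊗ₜ[R] (1 : H) * a' ᵍ⊗ₜ[R] c : 𝒜 ᵍ⊗[R] ℬ) = (a * a') ᵍ⊗ₜ[R] c := by
  rw [← tmul_one_mul_one_tmul 𝒜 ℬ a' c, ← mul_assoc]
  have h : (a ᵍ⊗ₜ[R] (1 : H) * a' ᵍ⊗ₜ[R] (1 : H) : 𝒜 ᵍ⊗[R] ℬ) = (a * a') ᵍ⊗ₜ[R] (1 : H) :=
    (map_mul (includeLeft 𝒜 ℬ) a a').symm
  rw [h, tmul_one_mul_one_tmul]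

/-- The coaction induced by a degree preserving algebra morphism out of a chain Hopf algebra is
multiplicative for the Koszul-signed product. -/
theorem HopfLaws.coaction_mul {G' : GradedChain R H'} {Δ' : H' →ₗ[R] H' ⊗[R] H'}
    {ε' : H' →ₗ[R] R} (hhopf' : HopfLaws G' Δ' ε') {G : GradedChain R H}
    [GradedAlgebra G'.gr] [GradedAlgebra G.gr] (p : H' →ₐ[R] H)
    (hp : ∀ n, ∀ x ∈ G'.gr n, p x ∈ G.gr n) (x y : H') :
    of R G'.gr G.gr (TensorProduct.map LinearMap.id p.toLinearMap (Δ' (x * y))) =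
      of R G'.gr G.gr (TensorProduct.map LinearMap.id p.toLinearMap (Δ' x)) *
        of R G'.gr G.gr (TensorProduct.map LinearMap.id p.toLinearMap (Δ' y)) := by
  obtain ⟨ι, t, a, b, db, hb, hx⟩ := exists_sum_tmul_homogeneous_right G'.internal (Δ' x)
  obtain ⟨ι', t', a', b', da', ha', hy⟩ := exists_sum_tmul_homogeneous_left G'.internal (Δ' y)
  rw [hhopf'.delta_mul ι ι' t t' a b db a' b' da' x y (fun i _ => hb i) (fun j _ => ha' j) hx hy,
    hx, hy]
  simp only [map_sum, Finset.sum_mul, Finset.mul_sum]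
  rw [Finset.sum_comm]
  refine Finset.sum_congr rfl fun j _ => Finset.sum_congr rfl fun i _ => ?_
  have h := tmul_coe_mul_coe_tmul G'.gr G.gr (a i) ⟨p (b i), hp _ _ (hb i)⟩ ⟨a' j, ha' j⟩
    (p (b' j))
  simp only [TensorProduct.map_tmul, LinearMap.id_apply, AlgHom.toLinearMap_apply, map_zsmul,
    map_mul]
  refine Eq.trans ?_ h.symm
  rw [Units.smul_def]
  congr 1

/-- The induced coaction as an algebra morphism into the graded tensor product. -/
noncomputable def HopfLaws.coactionHom {G' : GradedChain R H'} {Δ' : H' →ₗ[R] H' ⊗[R] H'}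
    {ε' : H' →ₗ[R] R} (hhopf' : HopfLaws G' Δ' ε') {G : GradedChain R H}
    [GradedAlgebra G'.gr] [GradedAlgebra G.gr] (p : H' →ₐ[R] H)
    (hp : ∀ n, ∀ x ∈ G'.gr n, p x ∈ G.gr n) : H' →ₐ[R] G'.gr ᵍ⊗[R] G.gr :=
  AlgHom.ofLinearMap
    ((of R G'.gr G.gr).toLinearMap ∘ₗ TensorProduct.map LinearMap.id p.toLinearMap ∘ₗ Δ')
    (by
      change of R G'.gr G.gr (TensorProduct.map LinearMap.id p.toLinearMap (Δ' 1)) = 1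
      rw [hhopf'.delta_one, TensorProduct.map_tmul, LinearMap.id_apply, AlgHom.toLinearMap_apply,
        map_one]
      rfl)
    (hhopf'.coaction_mul p hp)

/-- The induced coaction is compatible with the differentials on coinvariant elements. -/
theorem coaction_d_of_coinvariant {G' : GradedChain R H'} {Δ' : H' →ₗ[R] H' ⊗[R] H'}
    {ε' : H' →ₗ[R] R} (hcoalg' : ChainCoalgLaws G' Δ' ε') {G : GradedChain R H}
    (halg : ChainAlgLaws G) (p : H' →ₐ[R] H) (hp : ∀ x, p (G'.d x) = G.d (p x)) {x : H'}
    (hx : TensorProduct.map LinearMap.id p.toLinearMap (Δ' x) = x ⊗ₜ[R] (1 : H)) :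
    TensorProduct.map LinearMap.id p.toLinearMap (Δ' (G'.d x)) = G'.d x ⊗ₜ[R] (1 : H) := by
  obtain ⟨σ, hσ⟩ := exists_linearMap_eq_on_homogeneous G'.internal
    fun n => ((-1 : ℤ) ^ n) • (LinearMap.id : H' →ₗ[R] H')
  obtain ⟨ι, t, a, b, da, ha, hsum⟩ := exists_sum_tmul_homogeneous_left G'.internal (Δ' x)
  have hD : TensorProduct.map LinearMap.id p.toLinearMap (Δ' (G'.d x)) =
      (TensorProduct.map G'.d LinearMap.id + TensorProduct.map σ G.d : H' ⊗[R] H →ₗ[R] H' ⊗[R] H)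
        (TensorProduct.map LinearMap.id p.toLinearMap (Δ' x)) := by
    rw [hcoalg'.chain ι t a b da x (fun i _ => ha i) hsum, hsum]
    simp only [map_sum]
    refine Finset.sum_congr rfl fun i _ => ?_
    have hσi : σ (a i) = ((-1 : ℤ) ^ da i) • a i := hσ _ _ (ha i)
    simp only [LinearMap.add_apply, TensorProduct.map_tmul, map_add, map_zsmul, hσi,
      LinearMap.id_apply, AlgHom.toLinearMap_apply, hp, TensorProduct.smul_tmul']
  rw [hD, hx]
  simp [G.d_zero 1 halg.one_mem]

/-- The coaction of a product `b * s w` with `b` coinvariant and `s` a comultiplicative section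
of `p`. -/
theorem HopfLaws.coaction_coinvariant_mul_section {G' : GradedChain R H'}
    {Δ' : H' →ₗ[R] H' ⊗[R] H'} {ε' : H' →ₗ[R] R} (hhopf' : HopfLaws G' Δ' ε')
    {G : GradedChain R H} (halg' : ChainAlgLaws G') (halg : ChainAlgLaws G)
    {Δ : H →ₗ[R] H ⊗[R] H} {p : H' →ₐ[R] H} (hp : ∀ n, ∀ x ∈ G'.gr n, p x ∈ G.gr n)
    {s : H →ₐ[R] H'}
    (hs : ∀ x, TensorProduct.map s.toLinearMap s.toLinearMap (Δ x) = Δ' (s x))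
    (hps : ∀ x, p (s x) = x) {b : H'}
    (hb : TensorProduct.map LinearMap.id p.toLinearMap (Δ' b) = b ⊗ₜ[R] (1 : H)) (w : H) :
    TensorProduct.map LinearMap.id p.toLinearMap (Δ' (b * s w)) =
      TensorProduct.map (LinearMap.mulLeft R b ∘ₗ s.toLinearMap) LinearMap.id (Δ w) := by
  let _ : GradedAlgebra G'.gr := halg'.gradedAlgebra
  let _ : GradedAlgebra G.gr := halg.gradedAlgebra
  have hsw : TensorProduct.map LinearMap.id p.toLinearMap (Δ' (s w)) =
      TensorProduct.map s.toLinearMap LinearMap.id (Δ w) := by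
    have hpsl : p.toLinearMap ∘ₗ s.toLinearMap = LinearMap.id := LinearMap.ext hps
    rw [← hs, TensorProduct.map_map, hpsl, LinearMap.id_comp]
  have hmul : ∀ t : H ⊗[R] H,
      (b ᵍ⊗ₜ[R] (1 : H) : G'.gr ᵍ⊗[R] G.gr) *
          of R G'.gr G.gr (TensorProduct.map s.toLinearMap LinearMap.id t) =
        of R G'.gr G.gr
          (TensorProduct.map (LinearMap.mulLeft R b ∘ₗ s.toLinearMap) LinearMap.id t) := by
    intro t
    induction t using TensorProduct.induction_on with
    | zero => simp only [map_zero, mul_zero]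
    | add t u ht hu => simp only [map_add, mul_add, ht, hu]
    | tmul u v => exact tmul_one_mul_tmul G'.gr G.gr b (s u) v
  apply (of R G'.gr G.gr).injective
  rw [hhopf'.coaction_mul p hp, hb, hsw, hmul]

end GradedTensor

section Bundling

variable {H H' : Type} [Ring H'] [Algebra R H'] [Ring H] [Algebra R H]

/-- The coalgebra underlying a chain coalgebra. -/
@[reducible]
def ChainCoalgLaws.coalgebra {G : GradedChain R H} {Δ : H →ₗ[R] H ⊗[R] H} {ε : H →ₗ[R] R}
    (hG : ChainCoalgLaws G Δ ε) : Coalgebra R H where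
  comul := Δ
  counit := ε
  coassoc := LinearMap.ext hG.coassoc
  rTensor_counit_comp_comul := LinearMap.ext fun x =>
    (TensorProduct.lid R H).injective <| (hG.counit_l x).trans (by simp)
  lTensor_counit_comp_comul := LinearMap.ext fun x =>
    (TensorProduct.rid R H).injective <| (hG.counit_r x).trans (by simp)

/-- An algebra morphism compatible with counits and comultiplications as a bialgebra
morphism. -/
def bialgHomOfAlgHom [CoalgebraStruct R H] [CoalgebraStruct R H'] (f : H →ₐ[R] H')
    (hcounit : ∀ x, CoalgebraStruct.counit (R := R) (f x) = CoalgebraStruct.counit (R := R) x)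
    (hcomul : ∀ x, TensorProduct.map f.toLinearMap f.toLinearMap
      (CoalgebraStruct.comul (R := R) x) = CoalgebraStruct.comul (R := R) (f x)) :
    H →ₐc[R] H' :=
  { f.toLinearMap, (f : H →* H') with
    counit_comp := LinearMap.ext hcounit
    map_comp_comul := LinearMap.ext hcomul }

end Bundling

/-- Let `p : H' → H` be a surjective morphism of connected chain Hopf
algebras over a PID `R` (underlying graded modules free), let
`ν := (1 ⊗ p) ∘ Δ' : H' → H' ⊗ H` be the induced right `H`-comodule structure, and
suppose `p` admits a section `s` that is a morphism of graded Hopf algebras.  Then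
`B := H' □_H R` is a sub chain algebra of `H'`; the map `h := μ' ∘ (i ⊗ s) : B ⊗ H → H'`
is an isomorphism of graded right `H`-comodules and of graded left `B`-modules (so `H'`
is cofree as a nondifferential right `H`-comodule with cobasis `B`); and the transported
differential `h⁻¹ ∘ d' ∘ h` on `B ⊗ H` restricts on `B ⊗ 1` to `d_B ⊗ 1`. -/
theorem hopf_surjection_with_section_cofree
    (R : Type) [CommRing R] [IsDomain R] [IsPrincipalIdealRing R]
    -- the connected chain Hopf algebras `H'` and `H`
    (H' : Type) [Ring H'] [Algebra R H'] (GH' : GradedChain R H')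
    (Δ' : H' →ₗ[R] H' ⊗[R] H') (ε' : H' →ₗ[R] R)
    (halg' : ChainAlgLaws GH') (hcoalg' : ChainCoalgLaws GH' Δ' ε')
    (hhopf' : HopfLaws GH' Δ' ε') (hconn' : Connected GH')
    (H : Type) [Ring H] [Algebra R H] (GH : GradedChain R H)
    (Δ : H →ₗ[R] H ⊗[R] H) (ε : H →ₗ[R] R)
    (halg : ChainAlgLaws GH) (hcoalg : ChainCoalgLaws GH Δ ε)
    (hhopf : HopfLaws GH Δ ε) (hconn : Connected GH)
    -- the surjection `p` and its graded Hopf section `s`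
    (p : H' →ₐ[R] H) (hp : HopfMorLaws GH' Δ' ε' GH Δ ε p)
    (hpsurj : Function.Surjective p)
    (s : H →ₐ[R] H') (hs : GradedHopfMorLaws GH Δ ε GH' Δ' ε' s)
    (hps : ∀ x, p (s x) = x)
    -- the induced right `H`-coaction `ν = (1 ⊗ p) ∘ Δ'` and the cotensor product
    -- `B = H' □_H R = {x : ν x = x ⊗ 1}`
    (ν : H' →ₗ[R] H' ⊗[R] H)
    (hν : ν = (TensorProduct.map LinearMap.id p.toLinearMap) ∘ₗ Δ')
    (Bsub : Submodule R H')
    (hB : Bsub = LinearMap.ker (ν - (TensorProduct.mk R H' H).flip 1)) :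
    -- (1) `B` is a sub chain algebra of `H'`
    ((1 : H') ∈ Bsub) ∧
    (∀ x y : H', x ∈ Bsub → y ∈ Bsub → x * y ∈ Bsub) ∧
    (∀ x ∈ Bsub, GH'.d x ∈ Bsub) ∧
    -- (2) `h := μ' ∘ (i ⊗ s)` is an isomorphism of graded right `H`-comodules and of
    -- graded left `B`-modules, and (3) the transported differential restricts on
    -- `B ⊗ 1` to `d_B ⊗ 1`
    (∀ h : (↥Bsub) ⊗[R] H →ₗ[R] H',
      (∀ (x : Bsub) (w : H), h ((x : ↥Bsub) ⊗ₜ[R] w) = (x : H') * s w) →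
      Function.Bijective h ∧
      -- `h` is a morphism of right `H`-comodules
      (∀ z : (↥Bsub) ⊗[R] H,
        ν (h z) = (TensorProduct.map h LinearMap.id)
          ((TensorProduct.assoc R (↥Bsub) H H).symm
            ((TensorProduct.map LinearMap.id Δ) z))) ∧
      -- `h` is graded
      (∀ (i j : ℕ) (x : Bsub) (w : H), (x : H') ∈ GH'.gr i → w ∈ GH.gr j →
        h ((x : ↥Bsub) ⊗ₜ[R] w) ∈ GH'.gr (i + j)) ∧
      -- `h` is a morphism of left `B`-modules
      (∀ (b x : H') (hb : b ∈ Bsub) (hx : x ∈ Bsub) (hbx : b * x ∈ Bsub) (w : H),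
        h ((⟨b * x, hbx⟩ : ↥Bsub) ⊗ₜ[R] w) = b * h ((⟨x, hx⟩ : ↥Bsub) ⊗ₜ[R] w)) ∧
      -- (3) the transported differential `h⁻¹ ∘ d' ∘ h` restricts on `B ⊗ 1` to
      -- `d_B ⊗ 1`
      (∀ (x : H') (hx : x ∈ Bsub) (hdx : GH'.d x ∈ Bsub),
        h ((⟨GH'.d x, hdx⟩ : ↥Bsub) ⊗ₜ[R] (1 : H))
          = GH'.d (h ((⟨x, hx⟩ : ↥Bsub) ⊗ₜ[R] (1 : H))))) := by
  subst hν
  have hmem : ∀ x, x ∈ Bsub ↔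
      TensorProduct.map LinearMap.id p.toLinearMap (Δ' x) = x ⊗ₜ[R] (1 : H) := by
    intro x
    rw [hB, LinearMap.mem_ker, LinearMap.sub_apply, sub_eq_zero]
    rfl
  let _ : GradedAlgebra GH'.gr := halg'.gradedAlgebra
  let _ : GradedAlgebra GH.gr := halg.gradedAlgebra
  let N := hhopf'.coactionHom (G := GH) p hp.deg
  let j := GradedTensorProduct.includeLeft GH'.gr GH.gr
  have hmemN : ∀ x, x ∈ Bsub ↔ N x = j x := hmem
  have hone : (1 : H') ∈ Bsub := by rw [hmemN, map_one, map_one]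
  refine ⟨hone, fun x y hx hy => ?_, fun x hx => ?_, fun h hh => ?_⟩
  · rw [hmemN] at hx hy ⊢
    rw [map_mul, map_mul, hx, hy]
  · rw [hmem] at hx ⊢
    exact coaction_d_of_coinvariant hcoalg' halg p hp.chain hx
  let _ : Coalgebra R H' := hcoalg'.coalgebra
  let _ : Coalgebra R H := hcoalg.coalgebra
  let pb : H' →ₐc[R] H := bialgHomOfAlgHom p hp.counit hp.comul
  let sb : H →ₐc[R] H' := bialgHomOfAlgHom s hs.counit hs.comul
  have hνh : ∀ z : (↥Bsub) ⊗[R] H,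
      TensorProduct.map LinearMap.id p.toLinearMap (Δ' (h z)) =
        (TensorProduct.map h LinearMap.id) ((TensorProduct.assoc R (↥Bsub) H H).symm
          ((TensorProduct.map LinearMap.id Δ) z)) := by
    intro z
    induction z using TensorProduct.induction_on with
    | zero => simp only [map_zero]
    | add t u ht hu => simp only [map_add, ht, hu]
    | tmul b w =>
      have key : ∀ t : H ⊗[R] H,
          TensorProduct.map (LinearMap.mulLeft R (b : H') ∘ₗ s.toLinearMap) LinearMap.id t =
            TensorProduct.map h LinearMap.id
              ((TensorProduct.assoc R Bsub H H).symm (b ⊗ₜ[R] t)) := by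
        intro t
        induction t using TensorProduct.induction_on with
        | zero => simp
        | add t u ht hu => simp only [TensorProduct.tmul_add, map_add, ht, hu]
        | tmul u v => simp [hh]
      rw [hh, hhopf'.coaction_coinvariant_mul_section halg' halg hp.deg hs.comul hps
        ((hmem _).1 b.2), key, TensorProduct.map_tmul, LinearMap.id_apply]
  obtain ⟨S, hidS, hSid⟩ := exists_convInverse GH.internal hcoalg.deg
    (WithConv.toConv (LinearMap.id : H →ₗ[R] H)) fun x hx => by
      obtain ⟨r, rfl⟩ := Submodule.mem_span_singleton.1 (hconn.1 hx)
      change r • (1 : H) = algebraMap R H (ε (r • 1))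
      rw [map_smul, hhopf.eps_one, smul_eq_mul, mul_one, Algebra.algebraMap_eq_smul_one]
  refine ⟨?_, hνh, fun i j x w hx hw => ?_, fun b x hb hx hbx w => ?_, fun x hx hdx => ?_⟩
  · refine bijective_of_coinvariantProj_mem hidS hSid pb sb (fun x => ?_) h hh hνh
    rw [hmemN]
    refine coaction_comp_coinvariantProj hidS hSid pb sb hps N j
      (GradedTensorProduct.includeRight GH'.gr GH.gr).toLinearMap ?_ x
    refine WithConv.ofConv_injective (LinearMap.ext fun y => ?_)
    change GradedTensorProduct.of R GH'.gr GH.gr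
      (TensorProduct.map LinearMap.id p.toLinearMap (Δ' y)) =
        LinearMap.mul' R _ (TensorProduct.map _ _ (Δ' y))
    induction Δ' y using TensorProduct.induction_on with
    | zero => simp only [map_zero]
    | add t u ht hu => simp only [map_add, ht, hu]
    | tmul u v => exact (GradedTensorProduct.tmul_one_mul_one_tmul GH'.gr GH.gr u (p v)).symm
  · rw [hh]
    exact halg'.mul_mem _ _ _ _ hx (hs.deg _ _ hw)
  · rw [hh, hh, mul_assoc]
  · rw [hh, hh, map_one, mul_one, mul_one]

end Stmt11
end
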